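/- Let q_1,...,q_k : R^n -> R be degree-2 polynomials with E_{x ~ N(0,1)^n}[q_i(x)^2] = 1 for all i in [k], and let 0 < eps', eta < 1/4. Then there exist degree-2 polynomials p_1,...,p_k : R^n -> R and an integer 0 <= t <= k * ln(1/eta) / eps'^2 such that: (1) the random vectors (q_1(x),...,q_k(x)) for x ~ N(0,1)^n and (p_1(y),...,p_k(y)) for y ~ N(0,1)^n are identically distributed; and (2) for each l in [k], at least one of the following holds: (a) Var_{y ~ N(0,1)^n}[Tail_t(p_l)(y)] <= eta, or (b) lambda_max(Tail_t(p_l))^2 / Var[Tail_t(p_l)] <= eps'. -/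

import Mathlib

open MeasureTheory ProbabilityTheory Matrix

/-- The standard Gaussian measure `N(0,1)^n` on `ℝ^n`. -/
noncomputable def stdGaussian (n : ℕ) : Measure (Fin n → ℝ) :=
  MeasureTheory.Measure.pi fun _ => ProbabilityTheory.gaussianReal 0 1

/-- A degree-2 polynomial `x ↦ ∑_{i ≤ j} a i j * x i * x j + ∑_i b i * x i + c`. -/
noncomputable def qeval {n : ℕ} (a : Fin n → Fin n → ℝ) (b : Fin n → ℝ) (c : ℝ)
    (x : Fin n → ℝ) : ℝ :=
  (∑ i, ∑ j, if i ≤ j then a i j * x i * x j else 0) + (∑ i, b i * x i) + c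

/-- The `t`-tail of a degree-2 polynomial: the part not touching the first `t` coordinates. -/
noncomputable def tailEval {n : ℕ} (t : ℕ) (a : Fin n → Fin n → ℝ) (b : Fin n → ℝ) (c : ℝ)
    (x : Fin n → ℝ) : ℝ :=
  (∑ i : Fin n, ∑ j : Fin n, if t ≤ i.val ∧ i ≤ j then a i j * x i * x j else 0) +
    (∑ i : Fin n, if t ≤ i.val then b i * x i else 0) + c

/-- Upper-triangular coefficients of the quadratic part of the `t`-tail. -/
noncomputable def tailCoeff {n : ℕ} (t : ℕ) (a : Fin n → Fin n → ℝ) :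
    Fin n → Fin n → ℝ :=
  fun i j => if t ≤ i.val then a i j else 0

/-- The symmetric matrix `A` associated to upper-triangular quadratic coefficients `a`,
i.e. `A i j = a i j (1/2 + δ_{ij}/2)`, so that `xᵀ A x = ∑_{i ≤ j} a i j x i x j`. -/
noncomputable def symOf {n : ℕ} (a : Fin n → Fin n → ℝ) : Matrix (Fin n) (Fin n) ℝ :=
  Matrix.of fun i j => if i = j then a i i else (if i < j then a i j else a j i) / 2

/-- The degree-2 polynomial `x ↦ xᵀ S x + bᵀ x + c`. -/
noncomputable def quadEval {n : ℕ} (S : Matrix (Fin n) (Fin n) ℝ) (b : Fin n → ℝ) (c : ℝ)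
    (x : Fin n → ℝ) : ℝ :=
  x ⬝ᵥ S *ᵥ x + b ⬝ᵥ x + c

/-- The variance of `xᵀ S x + bᵀ x` under `N(0,1)^n`, for symmetric `S`. -/
noncomputable def quadVar {n : ℕ} (S : Matrix (Fin n) (Fin n) ℝ) (b : Fin n → ℝ) : ℝ :=
  2 * ∑ i, ∑ j, S i j ^ 2 + ∑ i, b i ^ 2

/-- The matrix `S` with its first `t` rows and columns set to zero. -/
noncomputable def maskMat {n : ℕ} (t : ℕ) (S : Matrix (Fin n) (Fin n) ℝ) :
    Matrix (Fin n) (Fin n) ℝ :=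
  Matrix.of fun i j => if t ≤ i.val ∧ t ≤ j.val then S i j else 0

/-- The vector `b` with its first `t` coordinates set to zero. -/
noncomputable def maskVec {n : ℕ} (t : ℕ) (b : Fin n → ℝ) : Fin n → ℝ :=
  fun i => if t ≤ i.val then b i else 0

/-- The upper-triangular coefficients of the quadratic form of a symmetric matrix. -/
noncomputable def upperCoeff {n : ℕ} (S : Matrix (Fin n) (Fin n) ℝ) : Fin n → Fin n → ℝ :=
  fun i j => if i = j then S i i else 2 * S i j

lemma symOf_transpose {n : ℕ} (a : Fin n → Fin n → ℝ) : (symOf a)ᵀ = symOf a := by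
  ext i j
  simp only [symOf, transpose_apply, of_apply]
  rcases lt_trichotomy i j with h | h | h
  · simp [h, h.ne, h.ne', h.not_gt]
  · simp [h]
  · simp [h, h.ne, h.ne', h.not_gt]

lemma symOf_upperCoeff {n : ℕ} {S : Matrix (Fin n) (Fin n) ℝ} (hS : Sᵀ = S) :
    symOf (upperCoeff S) = S := by
  ext i j
  have hij : S j i = S i j := by rw [← transpose_apply S, hS]
  simp only [symOf, upperCoeff, of_apply]
  split_ifs with h h1 h2
  all_goals first | (subst h; rfl) | (exfalso; omega) | linarith

lemma symOf_tailCoeff {n : ℕ} (t : ℕ) (a : Fin n → Fin n → ℝ) :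
    symOf (tailCoeff t a) = maskMat t (symOf a) := by
  ext i j
  simp only [symOf, tailCoeff, maskMat, of_apply]
  rcases lt_trichotomy i j with h | h | h
  · have h' : t ≤ i.val → t ≤ j.val := fun hi => hi.trans (by omega)
    by_cases hi : t ≤ i.val
    · simp [h, h.ne, hi, h' hi]
    · simp [h, h.ne, hi]
  · simp [h]
  · have h' : t ≤ j.val → t ≤ i.val := fun hi => hi.trans (by omega)
    by_cases hi : t ≤ j.val
    · simp [h.not_gt, h.ne', hi, h' hi]
    · simp [h.not_gt, h.ne', hi]

lemma qeval_eq_quadEval {n : ℕ} (a : Fin n → Fin n → ℝ) (b : Fin n → ℝ) (c : ℝ) :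
    qeval a b c = quadEval (symOf a) b c := by
  funext x
  simp only [qeval, quadEval, dotProduct, mulVec, Finset.mul_sum]
  congr 2
  have hsplit : ∀ i j : Fin n, x i * (symOf a i j * x j) =
      ((if i ≤ j then a i j * x i * x j else 0) +
        (if j ≤ i then a j i * x j * x i else 0)) / 2 := by
    intro i j
    simp only [symOf, of_apply]
    rcases lt_trichotomy i j with h | h | h
    · simp only [h, h.ne, h.le, h.not_ge, if_true, if_false]; ring
    · subst h; simp; ring
    · simp only [h.not_gt, h.ne', h.le, h.not_ge, if_true, if_false]; ring
  simp only [hsplit, ← Finset.sum_div, Finset.sum_add_distrib]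
  rw [Finset.sum_comm (f := fun i j : Fin n => if j ≤ i then a j i * x j * x i else 0)]
  ring

lemma tailEval_eq_quadEval {n : ℕ} (t : ℕ) (a : Fin n → Fin n → ℝ) (b : Fin n → ℝ) (c : ℝ) :
    tailEval t a b c = quadEval (maskMat t (symOf a)) (maskVec t b) c := by
  rw [← symOf_tailCoeff, ← qeval_eq_quadEval]
  funext x
  simp only [tailEval, qeval, tailCoeff, maskVec]
  congr 2
  · refine Finset.sum_congr rfl fun i _ => Finset.sum_congr rfl fun j _ => ?_
    by_cases h1 : t ≤ i.val <;> by_cases h2 : i ≤ j <;> simp [h1, h2]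
  · refine Finset.sum_congr rfl fun i _ => ?_
    by_cases h1 : t ≤ i.val <;> simp [h1]

lemma quadEval_mulVec {n : ℕ} (S U : Matrix (Fin n) (Fin n) ℝ) (b : Fin n → ℝ) (c : ℝ)
    (x : Fin n → ℝ) : quadEval S b c (U *ᵥ x) = quadEval (Uᵀ * S * U) (b ᵥ* U) c x := by
  simp only [quadEval, ← mulVec_mulVec, dotProduct_mulVec, vecMul_transpose]

lemma sum_sq_eq_trace {n : ℕ} (S : Matrix (Fin n) (Fin n) ℝ) :
    ∑ i, ∑ j, S i j ^ 2 = (Sᵀ * S).trace := by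
  simp only [trace, diag_apply, mul_apply, transpose_apply, ← sq]
  exact Finset.sum_comm

lemma quadVar_conj {n : ℕ} {U : Matrix (Fin n) (Fin n) ℝ} (hU : Uᵀ * U = 1)
    (S : Matrix (Fin n) (Fin n) ℝ) (b : Fin n → ℝ) :
    quadVar (Uᵀ * S * U) (b ᵥ* U) = quadVar S b := by
  have hU' : U * Uᵀ = 1 := mul_eq_one_comm.mp hU
  simp only [quadVar, sum_sq_eq_trace]
  congr 1
  · congr 1
    simp only [transpose_mul, transpose_transpose]
    calc (Uᵀ * (Sᵀ * U) * (Uᵀ * S * U)).trace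
        = (Uᵀ * (Sᵀ * (U * Uᵀ) * S * U)).trace := by simp only [Matrix.mul_assoc]
      _ = (Sᵀ * S * (U * Uᵀ)).trace := by
          rw [hU', Matrix.mul_one, trace_mul_comm, Matrix.mul_assoc, hU']
      _ = (Sᵀ * S).trace := by rw [hU', Matrix.mul_one]
  · have h : ∀ w : Fin n → ℝ, ∑ i, w i ^ 2 = w ⬝ᵥ w := fun w => by simp [dotProduct, sq]
    rw [h, h, ← mulVec_transpose, dotProduct_mulVec, vecMul_transpose, mulVec_mulVec, hU',
      one_mulVec]

lemma quadVar_nonneg {n : ℕ} (S : Matrix (Fin n) (Fin n) ℝ) (b : Fin n → ℝ) :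
    0 ≤ quadVar S b := by
  unfold quadVar; positivity

lemma maskMat_eq_diagonal {n : ℕ} (t : ℕ) (S : Matrix (Fin n) (Fin n) ℝ) :
    maskMat t S = diagonal (fun i : Fin n => if t ≤ i.val then 1 else 0) * S *
      diagonal (fun i : Fin n => if t ≤ i.val then 1 else 0) := by
  ext i j
  by_cases hi : t ≤ i.val <;> by_cases hj : t ≤ j.val <;>
    simp [maskMat, mul_diagonal, diagonal_mul, hi, hj]

lemma maskMat_transpose {n : ℕ} (t : ℕ) {S : Matrix (Fin n) (Fin n) ℝ} (hS : Sᵀ = S) :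
    (maskMat t S)ᵀ = maskMat t S := by
  rw [maskMat_eq_diagonal]
  simp only [transpose_mul, diagonal_transpose, hS, Matrix.mul_assoc]

lemma maskVec_eq_vecMul {n : ℕ} (t : ℕ) (b : Fin n → ℝ) :
    maskVec t b = b ᵥ* diagonal (fun i : Fin n => if t ≤ i.val then 1 else 0) := by
  ext i
  simp [maskVec, vecMul_diagonal]

/-- An orthogonal matrix taking one unit vector to another that commutes with every symmetric
matrix fixing both. -/
lemma exists_reflection {n : ℕ} (e v : Fin n → ℝ) (he : e ⬝ᵥ e = 1) (hv : v ⬝ᵥ v = 1) :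
    ∃ R : Matrix (Fin n) (Fin n) ℝ, Rᵀ * R = 1 ∧ R *ᵥ e = v ∧
      ∀ D : Matrix (Fin n) (Fin n) ℝ, Dᵀ = D → D *ᵥ e = e → D *ᵥ v = v → D * R = R * D := by
  by_cases hev : e = v
  · exact ⟨1, by simp, by simp [hev], by simp⟩
  set w := e - v with hw
  have hw0 : w ⬝ᵥ w ≠ 0 := by
    rw [Ne, dotProduct_self_eq_zero, hw, sub_eq_zero]
    exact hev
  have hww : w ⬝ᵥ w = 2 * (w ⬝ᵥ e) := by
    simp only [hw, sub_dotProduct, dotProduct_sub, he, hv, dotProduct_comm v e]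
    ring
  have hwe : w ⬝ᵥ e ≠ 0 := fun h => hw0 (by rw [hww, h, mul_zero])
  refine ⟨1 - (2 / (w ⬝ᵥ w)) • vecMulVec w w, ?_, ?_, ?_⟩
  · have h2 : vecMulVec w w * vecMulVec w w = (w ⬝ᵥ w) • vecMulVec w w := by
      rw [vecMulVec_mul_vecMulVec]
      ext i j
      simp [vecMulVec_apply, mul_left_comm]
    simp only [transpose_sub, transpose_one, transpose_smul, transpose_vecMulVec,
      Matrix.sub_mul, Matrix.mul_sub, Matrix.one_mul, Matrix.mul_one, Matrix.smul_mul,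
      Matrix.mul_smul, h2, smul_sub, smul_smul]
    have : (2 / w ⬝ᵥ w) * (2 / w ⬝ᵥ w * w ⬝ᵥ w) = 2 / w ⬝ᵥ w + 2 / w ⬝ᵥ w := by
      field_simp; ring
    rw [this, add_smul]
    abel
  · rw [sub_mulVec, one_mulVec, smul_mulVec, vecMulVec_mulVec]
    ext i
    have : 2 / (w ⬝ᵥ w) * (w ⬝ᵥ e) = 1 := by rw [hww]; field_simp
    simp only [Pi.sub_apply, Pi.smul_apply, smul_eq_mul, MulOpposite.smul_eq_mul_unop,
      MulOpposite.unop_op]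
    rw [mul_comm (w i), ← mul_assoc, this, hw]
    simp
  · intro D hD hDe hDv
    have hDw : D *ᵥ w = w := by rw [hw, mulVec_sub, hDe, hDv]
    have hwD : w ᵥ* D = w := by rw [← hD, vecMul_transpose, hDw]
    rw [Matrix.mul_sub, Matrix.sub_mul, Matrix.mul_smul, Matrix.smul_mul, mul_vecMulVec,
      vecMulVec_mul, hDw, hwD]
    simp

/-- Rotating a unit vector `v` of the tail space into coordinate `t` and then dropping that
coordinate removes at least `2 (vᵀ S v)²` from the variance of every tail. -/
lemma exists_rotation_tail {n t : ℕ} (v : Fin n → ℝ) (hv : v ⬝ᵥ v = 1)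
    (hvt : ∀ i : Fin n, i.val < t → v i = 0) :
    ∃ R : Matrix (Fin n) (Fin n) ℝ, Rᵀ * R = 1 ∧
      ∀ (S : Matrix (Fin n) (Fin n) ℝ) (b : Fin n → ℝ),
        quadVar (maskMat (t + 1) (Rᵀ * S * R)) (maskVec (t + 1) (b ᵥ* R)) +
          2 * (v ⬝ᵥ S *ᵥ v) ^ 2 ≤ quadVar (maskMat t S) (maskVec t b) := by
  have htn : t < n := by
    by_contra h
    have : v = 0 := funext fun i => hvt i (by omega)
    simp [this] at hv
  let τ : Fin n := ⟨t, htn⟩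
  obtain ⟨R, hR, hRe, hRD⟩ := exists_reflection (Pi.single τ 1) v (by simp) hv
  refine ⟨R, hR, fun S b => ?_⟩
  set d : Fin n → ℝ := fun i => if t ≤ i.val then 1 else 0 with hd
  have hcomm : diagonal d * R = R * diagonal d := by
    refine hRD _ (diagonal_transpose _) ?_ ?_
    · ext i
      by_cases h : i = τ
      · subst h; simp [hd, mulVec_diagonal, τ]
      · simp [mulVec_diagonal, h]
    · ext i
      rw [mulVec_diagonal]
      by_cases h : t ≤ i.val
      · simp [hd, h]
      · rw [hvt i (by omega), mul_zero]
  have hcomm' : Rᵀ * diagonal d = diagonal d * Rᵀ := by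
    have := congrArg transpose hcomm
    simpa only [transpose_mul, diagonal_transpose] using this
  have hM : maskMat t (Rᵀ * S * R) = Rᵀ * maskMat t S * R := by
    rw [maskMat_eq_diagonal, maskMat_eq_diagonal, ← hd]
    calc diagonal d * (Rᵀ * S * R) * diagonal d
        = (diagonal d * Rᵀ) * S * (R * diagonal d) := by simp only [Matrix.mul_assoc]
      _ = (Rᵀ * diagonal d) * S * (diagonal d * R) := by rw [hcomm, hcomm']
      _ = _ := by simp only [Matrix.mul_assoc]
  have hV : maskVec t (b ᵥ* R) = maskVec t b ᵥ* R := by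
    rw [maskVec_eq_vecMul, maskVec_eq_vecMul, ← hd, vecMul_vecMul, vecMul_vecMul, hcomm]
  have hconj := quadVar_conj hR (maskMat t S) (maskVec t b)
  rw [← hM, ← hV] at hconj
  rw [← hconj]
  have hentry : (Rᵀ * S * R) τ τ = v ⬝ᵥ S *ᵥ v := by
    have h1 : (Rᵀ * S * R) τ τ =
        Pi.single τ 1 ⬝ᵥ (Rᵀ * S * R) *ᵥ Pi.single τ (1 : ℝ) := by simp
    rw [h1, ← mulVec_mulVec, hRe, ← mulVec_mulVec, dotProduct_mulVec, vecMul_transpose, hRe]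
  rw [← hentry]
  generalize Rᵀ * S * R = Q
  generalize b ᵥ* R = β
  unfold quadVar
  have hle : ∀ i : Fin n, t + 1 ≤ i.val → t ≤ i.val := fun i hi => by omega
  have h1 : ∑ i, maskVec (t + 1) β i ^ 2 ≤ ∑ i, maskVec t β i ^ 2 := by
    refine Finset.sum_le_sum fun i _ => ?_
    unfold maskVec
    by_cases h : t + 1 ≤ i.val
    · simp [h, hle i h]
    · simp only [h, if_false]
      exact le_trans (by norm_num) (sq_nonneg _)
  have h2 : ∑ i, ∑ j, maskMat (t + 1) Q i j ^ 2 + Q τ τ ^ 2 ≤ ∑ i, ∑ j, maskMat t Q i j ^ 2 := by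
    have hτ : Q τ τ ^ 2 = ∑ i, ∑ j, if i = τ then (if j = τ then Q τ τ ^ 2 else 0) else 0 := by
      simp
    rw [hτ, ← Finset.sum_add_distrib]
    refine Finset.sum_le_sum fun i _ => ?_
    rw [← Finset.sum_add_distrib]
    refine Finset.sum_le_sum fun j _ => ?_
    simp only [maskMat, of_apply]
    by_cases h : t + 1 ≤ i.val ∧ t + 1 ≤ j.val
    · have hi : i ≠ τ := by rintro rfl; simp [τ] at h
      simp [h.1, h.2, hle i h.1, hle j h.2, hi]
    · by_cases hi : i = τ
      · by_cases hj : j = τ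
        · simp [hi, hj, τ]
        · simp only [h, hj, if_false, ite_self]
          exact le_trans (by norm_num) (sq_nonneg _)
      · simp only [h, hi, if_false]
        exact le_trans (by norm_num) (sq_nonneg _)
  linarith

/-- Repeatedly rotating a large eigenvector of a tail into the next coordinate terminates: some
rotation and some `t` leave every tail with small variance or only small eigenvalues. -/
lemma exists_rotation_regular_tails {n k : ℕ} {ε η : ℝ} (hε : 0 < ε) (hε4 : ε < 1 / 4)
    (hη : 0 < η) (S : Fin k → Matrix (Fin n) (Fin n) ℝ) (b : Fin k → Fin n → ℝ)
    (hS : ∀ l, quadVar (S l) (b l) ≤ 1) (hL : 1 ≤ Real.log (1 / η)) :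
    ∃ (U : Matrix (Fin n) (Fin n) ℝ) (t : ℕ), Uᵀ * U = 1 ∧
      (t : ℝ) ≤ k * Real.log (1 / η) / ε ^ 2 ∧ ∀ l,
        quadVar (maskMat t (Uᵀ * S l * U)) (maskVec t (b l ᵥ* U)) ≤ η ∨
        ∀ (v : Fin n → ℝ) (μ : ℝ), v ⬝ᵥ v = 1 → maskMat t (Uᵀ * S l * U) *ᵥ v = μ • v →
          μ ^ 2 ≤ ε * quadVar (maskMat t (Uᵀ * S l * U)) (maskVec t (b l ᵥ* U)) := by
  set L := Real.log (1 / η) with hLdef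
  by_contra! hbad
  have hbound : ∀ {t : ℕ} {h : Fin k → ℕ}, ∑ l, h l = t → (∀ l, (h l : ℝ) ≤ L / ε ^ 2) →
      (t : ℝ) ≤ k * L / ε ^ 2 := by
    intro t h hsum hh
    rw [← hsum, Nat.cast_sum]
    refine (Finset.sum_le_sum fun l _ => hh l).trans (le_of_eq ?_)
    simp [mul_div_assoc]
  have hstep : ∀ t : ℕ, ∃ (U : Matrix (Fin n) (Fin n) ℝ) (h : Fin k → ℕ), Uᵀ * U = 1 ∧
      ∑ l, h l = t ∧ (∀ l, (h l : ℝ) ≤ L / ε ^ 2) ∧ ∀ l,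
        quadVar (maskMat t (Uᵀ * S l * U)) (maskVec t (b l ᵥ* U)) ≤ (1 - 2 * ε) ^ h l := by
    intro t
    induction t with
    | zero =>
      refine ⟨1, 0, by simp, by simp, fun l => by simp; positivity, fun l => ?_⟩
      have h1 : maskMat 0 (S l) = S l := by ext i j; simp [maskMat]
      have h2 : maskVec 0 (b l) = b l := by ext i; simp [maskVec]
      simpa [h1, h2] using hS l
    | succ t ih =>
      obtain ⟨U, h, hU, hsum, hh, hV⟩ := ih
      obtain ⟨l, hlη, v, μ, hv, hμ, hlarge⟩ := hbad U t hU (hbound hsum hh)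
      have hVnonneg := quadVar_nonneg (maskMat t (Uᵀ * S l * U)) (maskVec t (b l ᵥ* U))
      have hμ0 : μ ≠ 0 := by
        rintro rfl
        nlinarith
      have hvt : ∀ i : Fin n, i.val < t → v i = 0 := by
        intro i hi
        have hrow := congrFun hμ i
        simp only [mulVec, dotProduct, maskMat, of_apply, Pi.smul_apply, smul_eq_mul,
          not_le.mpr hi, false_and, if_false, zero_mul, Finset.sum_const_zero] at hrow
        exact (mul_eq_zero.mp hrow.symm).resolve_left hμ0
      have hvS : v ⬝ᵥ (Uᵀ * S l * U) *ᵥ v = μ := by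
        have hmask : v ⬝ᵥ (Uᵀ * S l * U) *ᵥ v = v ⬝ᵥ maskMat t (Uᵀ * S l * U) *ᵥ v := by
          simp only [dotProduct, mulVec, maskMat, of_apply]
          refine Finset.sum_congr rfl fun i _ => ?_
          by_cases hi : i.val < t
          · simp [hvt i hi]
          · congr 1
            refine Finset.sum_congr rfl fun j _ => ?_
            by_cases hj : j.val < t
            · simp [hvt j hj]
            · simp [not_lt.mp hi, not_lt.mp hj]
        rw [hmask, hμ, dotProduct_smul, hv, smul_eq_mul, mul_one]
      obtain ⟨R, hR, hdrop⟩ := exists_rotation_tail v hv hvt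
      have hconj : ∀ m, (U * R)ᵀ * S m * (U * R) = Rᵀ * (Uᵀ * S m * U) * R := fun m => by
        simp only [transpose_mul, Matrix.mul_assoc]
      have hconjb : ∀ m, b m ᵥ* (U * R) = (b m ᵥ* U) ᵥ* R := fun m => by
        rw [vecMul_vecMul]
      have hlt : (h l : ℝ) < L / (2 * ε) := by
        have h1 : η < Real.exp (-(2 * ε)) ^ h l :=
          (hlη.trans_le (hV l)).trans_le (pow_le_pow_left₀ (by linarith)
            (by linarith [Real.add_one_le_exp (-(2 * ε))]) _)
        rw [← Real.exp_nat_mul, ← Real.log_lt_iff_lt_exp hη] at h1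
        rw [lt_div_iff₀ (by positivity), hLdef, one_div, Real.log_inv]
        linarith
      have hsucc : (h l : ℝ) + 1 ≤ L / ε ^ 2 := by
        have h1 : L / (2 * ε) + 1 ≤ L / ε ^ 2 := by
          rw [div_add_one (by positivity), div_le_div_iff₀ (by positivity) (by positivity)]
          nlinarith [mul_pos hε hε, mul_le_mul_of_nonneg_right hL hε.le,
            mul_le_mul_of_nonneg_right hL (mul_pos hε hε).le]
        linarith
      refine ⟨U * R, h + Pi.single l 1, ?_, ?_, fun m => ?_, fun m => ?_⟩
      · rw [transpose_mul, Matrix.mul_assoc, ← Matrix.mul_assoc Uᵀ, hU, Matrix.one_mul, hR]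
      · simp [Finset.sum_add_distrib, hsum]
      · by_cases hm : m = l
        · subst hm; simpa using hsucc
        · simpa [hm] using hh m
      · rw [hconj, hconjb]
        have hd := hdrop (Uᵀ * S m * U) (b m ᵥ* U)
        by_cases hm : m = l
        · subst hm
          rw [hvS] at hd
          simp only [Pi.add_apply, Pi.single_eq_same, pow_succ]
          have := mul_le_mul_of_nonneg_right (hV m) (by linarith : 0 ≤ 1 - 2 * ε)
          linarith
        · simp only [Pi.add_apply, Pi.single_eq_of_ne hm, add_zero]
          linarith [hV m, sq_nonneg (v ⬝ᵥ (Uᵀ * S m * U) *ᵥ v)]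
  obtain ⟨t, ht⟩ := exists_nat_gt (k * L / ε ^ 2)
  obtain ⟨U, h, -, hsum, hh, -⟩ := hstep t
  exact absurd (hbound hsum hh) (not_le.mpr ht)

lemma map_mulVec_stdGaussian {n : ℕ} {U : Matrix (Fin n) (Fin n) ℝ} (hU : Uᵀ * U = 1) :
    Measure.map (fun x => U *ᵥ x) (_root_.stdGaussian n) = _root_.stdGaussian n := by
  let f : EuclideanSpace ℝ (Fin n) →ₗᵢ[ℝ] EuclideanSpace ℝ (Fin n) :=
    { toLinearMap := toEuclideanLin U
      norm_map' := fun x => by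
        rw [← sq_eq_sq₀ (norm_nonneg _) (norm_nonneg _), EuclideanSpace.real_norm_sq_eq,
          EuclideanSpace.real_norm_sq_eq]
        have h : ∀ w : Fin n → ℝ, ∑ i, w i ^ 2 = w ⬝ᵥ w := fun w => by simp [dotProduct, sq]
        rw [h x.ofLp, h (toEuclideanLin U x).ofLp]
        change (U *ᵥ x.ofLp) ⬝ᵥ (U *ᵥ x.ofLp) = _
        rw [dotProduct_mulVec, ← mulVec_transpose, mulVec_mulVec, hU, one_mulVec] }
  let g := f.toLinearIsometryEquiv rfl
  have hg := ProbabilityTheory.stdGaussian_map g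
  have hpi := map_pi_eq_stdGaussian (ι := Fin n)
  have hback : Measure.map (WithLp.ofLp (p := 2))
      (ProbabilityTheory.stdGaussian (EuclideanSpace ℝ (Fin n))) = _root_.stdGaussian n := by
    rw [← hpi, Measure.map_map (by fun_prop) (by fun_prop)]
    exact Measure.map_id
  conv_rhs => rw [← hback, ← hg, ← hpi]
  rw [Measure.map_map (by fun_prop) (by fun_prop), Measure.map_map (by fun_prop) (by fun_prop)]
  rfl

lemma integral_pow_two_three_four_gaussianReal :
    ∫ x, x ^ 2 ∂(gaussianReal 0 1) = 1 ∧ ∫ x, x ^ 3 ∂(gaussianReal 0 1) = 0 ∧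
      ∫ x, x ^ 4 ∂(gaussianReal 0 1) = 3 := by
  have key : ∀ m : ℕ, iteratedDeriv m (fun t : ℝ => Real.exp (t ^ 2 / 2)) 0 =
      ∫ x, x ^ m ∂(gaussianReal 0 1) := by
    intro m
    have h := iteratedDeriv_mgf_zero (X := id) (μ := gaussianReal 0 1) (by simp) m
    simpa [mgf_id_gaussianReal] using h
  have he : ∀ t : ℝ, HasDerivAt (fun t : ℝ => Real.exp (t ^ 2 / 2))
      (t * Real.exp (t ^ 2 / 2)) t := fun t => by
    have := ((hasDerivAt_pow 2 t).div_const 2).exp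
    convert this using 1
    push_cast; ring
  have step : ∀ (p p' : ℝ → ℝ), (∀ t, HasDerivAt p (p' t) t) →
      deriv (fun t : ℝ => p t * Real.exp (t ^ 2 / 2)) =
        fun t => (p' t + p t * t) * Real.exp (t ^ 2 / 2) := fun p p' hp => by
    funext t
    rw [((hp t).fun_mul (he t)).deriv]
    ring
  have d1 : deriv (fun t : ℝ => Real.exp (t ^ 2 / 2)) = fun t => t * Real.exp (t ^ 2 / 2) :=
    funext fun t => (he t).deriv
  have d2 := step (fun t => t) (fun _ => 1) (fun t => hasDerivAt_id t)
  have d3 := step (fun t => 1 + t * t) (fun t => 2 * t) (fun t =>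
    (((hasDerivAt_id' t).fun_mul (hasDerivAt_id' t)).const_add 1).congr_deriv (by ring))
  have d4 := step (fun t => 2 * t + (1 + t * t) * t) (fun t => 3 + 3 * t ^ 2) (fun t =>
    (((hasDerivAt_id' t).const_mul 2).fun_add
      ((((hasDerivAt_id' t).fun_mul (hasDerivAt_id' t)).const_add 1).fun_mul
        (hasDerivAt_id' t))).congr_deriv (by ring))
  refine ⟨?_, ?_, ?_⟩ <;> rw [← key] <;> simp only [iteratedDeriv_succ', iteratedDeriv_zero]
  · rw [d1, d2]; simp
  · rw [d1, d2, d3]; simp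
  · rw [d1, d2, d3, d4]; simp

lemma integrable_pow_gaussianReal (m : ℕ) : Integrable (fun x => x ^ m) (gaussianReal 0 1) := by
  have h1 := integrable_exp_mul_gaussianReal (μ := 0) (v := 1) 1
  have h2 := integrable_exp_mul_gaussianReal (μ := 0) (v := 1) (-1)
  exact integrable_pow_of_integrable_exp_mul (X := fun x => x) one_ne_zero h1 h2 m

lemma memLp_mul_sq_add_mul_gaussianReal (s β : ℝ) :
    MemLp (fun x => s * x ^ 2 + β * x) 2 (gaussianReal 0 1) := by
  rw [memLp_two_iff_integrable_sq (by fun_prop)]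
  have : (fun x : ℝ => (s * x ^ 2 + β * x) ^ 2) =
      fun x => s ^ 2 * x ^ 4 + 2 * s * β * x ^ 3 + β ^ 2 * x ^ 2 := by
    funext x; ring
  rw [this]
  exact (((integrable_pow_gaussianReal 4).const_mul _).add
    ((integrable_pow_gaussianReal 3).const_mul _)).add ((integrable_pow_gaussianReal 2).const_mul _)

lemma variance_mul_sq_add_mul_gaussianReal (s β : ℝ) :
    variance (fun x => s * x ^ 2 + β * x) (gaussianReal 0 1) = 2 * s ^ 2 + β ^ 2 := by
  obtain ⟨h2, h3, h4⟩ := integral_pow_two_three_four_gaussianReal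
  have i1 : Integrable (fun x : ℝ => x) (gaussianReal 0 1) := by
    simpa using integrable_pow_gaussianReal 1
  have i2 := integrable_pow_gaussianReal 2
  have i3 := integrable_pow_gaussianReal 3
  have i4 := integrable_pow_gaussianReal 4
  have h1 : ∫ x, β * x ∂(gaussianReal 0 1) = 0 := by
    rw [integral_const_mul, integral_id_gaussianReal, mul_zero]
  rw [variance_eq_sub (memLp_mul_sq_add_mul_gaussianReal s β)]
  have hsq : ((fun x : ℝ => s * x ^ 2 + β * x) ^ 2) =
      fun x => s ^ 2 * x ^ 4 + 2 * s * β * x ^ 3 + β ^ 2 * x ^ 2 := by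
    funext x; simp only [Pi.pow_apply]; ring
  have i43 : Integrable (fun x : ℝ => s ^ 2 * x ^ 4 + 2 * s * β * x ^ 3) (gaussianReal 0 1) :=
    (i4.const_mul _).add (i3.const_mul _)
  rw [hsq, integral_add i43 (i2.const_mul _),
    integral_add (i4.const_mul _) (i3.const_mul _), integral_add (i2.const_mul _) (i1.const_mul _)]
  simp only [integral_const_mul, h1, h2, h3, h4]
  ring

lemma variance_quadEval_diagonal {n : ℕ} (s b : Fin n → ℝ) (c : ℝ) :
    variance (quadEval (diagonal s) b c) (_root_.stdGaussian n) = quadVar (diagonal s) b := by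
  have h := variance_sum_pi (μ := fun _ : Fin n => gaussianReal 0 1)
    (X := fun i x => s i * x ^ 2 + b i * x)
    (fun i => memLp_mul_sq_add_mul_gaussianReal (s i) (b i))
  have hf : quadEval (diagonal s) b c = fun x : Fin n → ℝ =>
      (∑ i, fun x : Fin n → ℝ => s i * x i ^ 2 + b i * x i) x + c := by
    funext x
    simp only [quadEval, dotProduct, mulVec_diagonal, Finset.sum_apply, Finset.sum_add_distrib]
    congr 2
    exact Finset.sum_congr rfl fun i _ => by ring
  have : IsProbabilityMeasure (_root_.stdGaussian n) := by
    unfold _root_.stdGaussian; infer_instance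
  rw [hf, variance_add_const (by fun_prop)]
  refine h.trans ?_
  simp only [variance_mul_sq_add_mul_gaussianReal, quadVar, Finset.sum_add_distrib,
    ← Finset.mul_sum]
  congr 2
  refine Finset.sum_congr rfl fun i _ => ?_
  rw [Finset.sum_eq_single i (fun j _ hj => by simp [diagonal_apply_ne _ hj.symm]) (by simp)]
  simp

@[fun_prop]
lemma measurable_quadEval {n : ℕ} (S : Matrix (Fin n) (Fin n) ℝ) (b : Fin n → ℝ) (c : ℝ) :
    Measurable (quadEval S b c) := by
  unfold quadEval dotProduct mulVec dotProduct
  fun_prop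

lemma measurable_mulVec {n : ℕ} (U : Matrix (Fin n) (Fin n) ℝ) :
    Measurable (fun x : Fin n → ℝ => U *ᵥ x) := by
  unfold mulVec dotProduct
  fun_prop

lemma variance_quadEval {n : ℕ} {S : Matrix (Fin n) (Fin n) ℝ} (hS : Sᵀ = S) (b : Fin n → ℝ)
    (c : ℝ) : variance (quadEval S b c) (_root_.stdGaussian n) = quadVar S b := by
  have hH : S.IsHermitian := by rwa [IsHermitian, conjTranspose_eq_transpose_of_trivial]
  let U : Matrix (Fin n) (Fin n) ℝ := hH.eigenvectorUnitary
  have hU : Uᵀ * U = 1 := by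
    have := Unitary.coe_star_mul_self hH.eigenvectorUnitary
    rwa [star_eq_conjTranspose, conjTranspose_eq_transpose_of_trivial] at this
  have hD : Uᵀ * S * U = diagonal hH.eigenvalues := by
    have := hH.conjStarAlgAut_star_eigenvectorUnitary
    rw [Unitary.conjStarAlgAut_star_apply, star_eq_conjTranspose,
      conjTranspose_eq_transpose_of_trivial] at this
    exact this
  rw [← map_mulVec_stdGaussian hU, variance_map (by fun_prop) (measurable_mulVec U).aemeasurable,
    ← quadVar_conj hU, hD, ← variance_quadEval_diagonal _ _ c, ← hD]
  congr 1
  funext x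
  exact quadEval_mulVec S U b c x

/-- the `Change-Basis` lemma.  Given `k` degree-2 polynomials
`q i = qeval (a i) (b i) (c i)` with `E[q_i²] = 1` under `N(0,1)^n`, there exist degree-2
polynomials `p i = qeval (a' i) (b' i) (c' i)` and `0 ≤ t ≤ k ln(1/η)/ε'²` such that (1) the
random vectors `(q_1(x),…,q_k(x))` and `(p_1(y),…,p_k(y))` are identically distributed, and
(2) each `p l` has `Var[Tail_t(p_l)] ≤ η` or `λ_max(Tail_t(p_l))²/Var[Tail_t(p_l)] ≤ ε'`
(the latter expressed for every eigenvalue of the symmetric matrix of the quadratic part of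
the tail). -/
theorem stmt_19 (n k : ℕ) (a : Fin k → Fin n → Fin n → ℝ) (b : Fin k → Fin n → ℝ)
    (c : Fin k → ℝ) (ε' η : ℝ) (hε' : 0 < ε') (hε'4 : ε' < 1 / 4)
    (hη : 0 < η) (hη4 : η < 1 / 4)
    (hq : ∀ i, ∫ x, (qeval (a i) (b i) (c i) x) ^ 2 ∂(stdGaussian n) = 1) :
    ∃ (a' : Fin k → Fin n → Fin n → ℝ) (b' : Fin k → Fin n → ℝ) (c' : Fin k → ℝ) (t : ℕ),
      (t : ℝ) ≤ k * Real.log (1 / η) / ε' ^ 2 ∧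
      Measure.map (fun x => fun i => qeval (a i) (b i) (c i) x) (stdGaussian n) =
        Measure.map (fun y => fun i => qeval (a' i) (b' i) (c' i) y) (stdGaussian n) ∧
      ∀ l : Fin k,
        variance (tailEval t (a' l) (b' l) (c' l)) (stdGaussian n) ≤ η ∨
        ∀ (hH : (symOf (tailCoeff t (a' l))).IsHermitian) (i0 : Fin n),
          (hH.eigenvalues i0) ^ 2 /
              variance (tailEval t (a' l) (b' l) (c' l)) (stdGaussian n) ≤ ε' := by
  have hprob : IsProbabilityMeasure (_root_.stdGaussian n) := by
    unfold _root_.stdGaussian; infer_instance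
  have hV : ∀ l, quadVar (symOf (a l)) (b l) ≤ 1 := fun l => by
    rw [← variance_quadEval (symOf_transpose (a l)) (b l) (c l), ← hq l, qeval_eq_quadEval]
    exact variance_le_expectation_sq (by fun_prop)
  have hL : 1 ≤ Real.log (1 / η) := by
    rw [Real.le_log_iff_exp_le (by positivity), le_div_iff₀ hη]
    nlinarith [Real.exp_one_lt_d9]
  obtain ⟨U, t, hU, ht, htail⟩ := exists_rotation_regular_tails hε' hε'4 hη
    (fun l => symOf (a l)) b hV hL
  have hsym : ∀ l, symOf (upperCoeff (Uᵀ * symOf (a l) * U)) = Uᵀ * symOf (a l) * U := fun l =>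
    symOf_upperCoeff (by simp [transpose_mul, symOf_transpose, Matrix.mul_assoc])
  refine ⟨fun l => upperCoeff (Uᵀ * symOf (a l) * U), fun l => b l ᵥ* U, c, t, ht, ?_,
    fun l => ?_⟩
  · simp only [qeval_eq_quadEval, hsym]
    conv_lhs => rw [← map_mulVec_stdGaussian hU]
    rw [Measure.map_map (by fun_prop) (measurable_mulVec U)]
    simp only [Function.comp_def, quadEval_mulVec]
  · simp only [tailEval_eq_quadEval, symOf_tailCoeff, hsym]
    rw [variance_quadEval (maskMat_transpose t (by
      simp [transpose_mul, symOf_transpose, Matrix.mul_assoc]))]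
    refine or_iff_not_imp_left.mpr fun hlη hH i => ?_
    rw [div_le_iff₀ (hη.trans (not_le.mp hlη))]
    refine (htail l).resolve_left hlη (hH.eigenvectorBasis i).ofLp _ ?_
      (hH.mulVec_eigenvectorBasis i)
    have hnorm := hH.eigenvectorBasis.orthonormal.1 i
    rw [← sq_eq_sq₀ (norm_nonneg _) zero_le_one, EuclideanSpace.real_norm_sq_eq] at hnorm
    simpa [dotProduct, ← sq] using hnorm
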